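/- Let p be a prime, n ≥ 2, and F a field containing a primitive p-th root of unity ζ, with a fixed algebraic closure Ω. Let K/F be a finite Galois extension inside Ω equipped with a group isomorphism e : Gal(K/F) ≅ U_n(F_p), compatible with a₁, …, a_{n−1} ∈ F^×. Let a_n ∈ F^× and w ∈ K^× with N_{K/F}(w) = a_n, and assume a₁, …, a_n are linearly independent in F^×/(F^×)^p. For σ ∈ Gal(K/F) let λ_σ ∈ {0, …, p−1} be the integer representing the top-right entry (e(σ))_{1,n} ∈ F_p, and set v = ∏_{σ ∈ Gal(K/F)} σ(w)^{λ_σ} ∈ K^×. Let β ∈ Ω with β^p = v and let M be the normal closure of K(β) over F inside Ω. Then M/F is a finite Galois extension, and there exists a group isomorphism e' : Gal(M/F) ≅ U_{n+1}(F_p) such that M/F is compatible with a₁, …, a_n, i.e. there exist α₁, …, α_n ∈ M with αᵢ^p = aᵢ and σ(αᵢ) = ζ^{sᵢ(e'(σ))}·αᵢ for every σ ∈ Gal(M/F). -/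

import Mathlib

/-- `g` is an upper unitriangular matrix. -/
def IsUni {n : ℕ} {R : Type*} [CommRing R] (g : Matrix (Fin n) (Fin n) R) : Prop :=
  (∀ i, g i i = 1) ∧ ∀ i j : Fin n, (j : ℕ) < (i : ℕ) → g i j = 0

theorem isUni_one {n : ℕ} {R : Type*} [CommRing R] :
    IsUni (1 : Matrix (Fin n) (Fin n) R) :=
  ⟨fun i => Matrix.one_apply_eq i,
   fun i j hij => Matrix.one_apply_ne (by rintro rfl; exact absurd hij (lt_irrefl _))⟩

theorem isUni_mul {n : ℕ} {R : Type*} [CommRing R] {A B : Matrix (Fin n) (Fin n) R}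
    (hA : IsUni A) (hB : IsUni B) : IsUni (A * B) := by
  constructor
  · intro i
    rw [Matrix.mul_apply, Finset.sum_eq_single i]
    · rw [hA.1 i, hB.1 i, one_mul]
    · intro k _ hk
      have hk' : (k : ℕ) ≠ (i : ℕ) := fun h => hk (Fin.ext h)
      rcases Nat.lt_or_ge (k : ℕ) (i : ℕ) with h | h
      · rw [hA.2 i k h, zero_mul]
      · rw [hB.2 k i (by omega), mul_zero]
    · intro hi; exact absurd (Finset.mem_univ i) hi
  · intro i j hij
    rw [Matrix.mul_apply]
    refine Finset.sum_eq_zero fun k _ => ?_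
    rcases Nat.lt_or_ge (k : ℕ) (i : ℕ) with h | h
    · rw [hA.2 i k h, zero_mul]
    · rw [hB.2 k j (by omega), mul_zero]

/-- The group `U_n(F_p)` of upper unitriangular `n × n` matrices over `F_p`, realized as a
subgroup of the units of the matrix ring. -/
def Uni (n p : ℕ) [NeZero p] : Subgroup (Matrix (Fin n) (Fin n) (ZMod p))ˣ where
  carrier := {g | IsUni (g : Matrix (Fin n) (Fin n) (ZMod p))}
  one_mem' := by simpa using isUni_one
  mul_mem' {a b} ha hb := by simpa [Units.val_mul] using isUni_mul ha hb
  inv_mem' {g} hg := by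
    have hpow : ∀ k : ℕ, IsUni ((↑(g ^ k) : Matrix (Fin n) (Fin n) (ZMod p))) := by
      intro k
      induction k with
      | zero => simpa using isUni_one
      | succ k ih => rw [pow_succ, Units.val_mul]; exact isUni_mul ih hg
    have h1 : g ^ (orderOf g - 1) * g = 1 := by
      rw [← pow_succ, Nat.sub_add_cancel (orderOf_pos g), pow_orderOf_eq_one]
    have h2 : g⁻¹ = g ^ (orderOf g - 1) := inv_eq_of_mul_eq_one_left h1
    show IsUni ((↑(g⁻¹) : Matrix (Fin n) (Fin n) (ZMod p)))
    rw [h2]; exact hpow _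

/-- The `(i, j)` entry of an element of `U_n(F_p)`. -/
def entry {n p : ℕ} [NeZero p] (g : ↥(Uni n p)) (i j : Fin n) : ZMod p :=
  ((g : (Matrix (Fin n) (Fin n) (ZMod p))ˣ) : Matrix (Fin n) (Fin n) (ZMod p)) i j

open IntermediateField

namespace UniAux

theorem isUni_upper {n : ℕ} {R : Type*} [CommRing R] {A : Matrix (Fin n) (Fin n) R}
    (hA : IsUni A) : A.BlockTriangular id := fun i j hij => hA.2 i j hij

theorem isUni_det {n : ℕ} {R : Type*} [CommRing R] {A : Matrix (Fin n) (Fin n) R}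
    (hA : IsUni A) : A.det = 1 := by
  rw [Matrix.det_of_isUpperTriangular (isUni_upper hA)]
  exact Finset.prod_eq_one fun i _ => hA.1 i

noncomputable def mk {n p : ℕ} [NeZero p] (A : Matrix (Fin n) (Fin n) (ZMod p)) (hA : IsUni A) :
    ↥(Uni n p) :=
  ⟨A.nonsingInvUnit (by rw [isUni_det hA]; exact isUnit_one), hA⟩

theorem entry_mk {n p : ℕ} [NeZero p] (A : Matrix (Fin n) (Fin n) (ZMod p)) (hA : IsUni A)
    (i j : Fin n) : entry (mk A hA) i j = A i j := rfl

theorem ext' {n p : ℕ} [NeZero p] {g h : ↥(Uni n p)}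
    (H : ∀ i j, entry g i j = entry h i j) : g = h := by
  apply Subtype.ext
  apply Units.ext
  ext i j
  exact H i j

theorem entry_mul {n p : ℕ} [NeZero p] (g h : ↥(Uni n p)) (i j : Fin n) :
    entry (g * h) i j = ∑ k, entry g i k * entry h k j := by
  simp [entry, Matrix.mul_apply]

theorem entry_one {n p : ℕ} [NeZero p] (i j : Fin n) :
    entry (1 : ↥(Uni n p)) i j = if i = j then 1 else 0 := by
  simp [entry, Matrix.one_apply]

theorem entry_isUni {n p : ℕ} [NeZero p] (g : ↥(Uni n p)) :
    IsUni (fun i j => entry g i j : Matrix (Fin n) (Fin n) (ZMod p)) := g.2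

theorem entry_diag {n p : ℕ} [NeZero p] (g : ↥(Uni n p)) (i : Fin n) : entry g i i = 1 :=
  g.2.1 i

theorem entry_lower {n p : ℕ} [NeZero p] (g : ↥(Uni n p)) {i j : Fin n} (h : j < i) :
    entry g i j = 0 := g.2.2 i j h

theorem isPGroup (n p : ℕ) [Fact p.Prime] [NeZero p] : IsPGroup p ↥(Uni n p) := by
  intro g
  refine ⟨n, ?_⟩
  apply Subtype.ext
  apply Units.ext
  set A : Matrix (Fin n) (Fin n) (ZMod p) := ((g : (Matrix (Fin n) (Fin n) (ZMod p))ˣ) :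
    Matrix (Fin n) (Fin n) (ZMod p)) with hA
  have hU : IsUni A := g.2
  have h1 : (A - 1) ^ n = 0 := by
    have := Matrix.aeval_self_charpoly A
    rw [Matrix.charpoly_of_isUpperTriangular _ (isUni_upper hU)] at this
    simpa [hU.1, map_prod] using this
  have h2 : (A - 1) ^ (p ^ n) = 0 :=
    pow_eq_zero_of_le (Nat.lt_pow_self (Fact.out : p.Prime).one_lt).le h1
  have h3 : A ^ p ^ n = 1 := by
    rcases Nat.eq_zero_or_pos n with rfl | hn
    · exact Subsingleton.elim _ _
    have : Nonempty (Fin n) := ⟨⟨0, hn⟩⟩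
    have : CharP (Matrix (Fin n) (Fin n) (ZMod p)) p := inferInstance
    rw [sub_pow_char_pow_of_commute p n (Commute.one_right A)] at h2
    simpa [sub_eq_zero] using h2
  simpa using h3

theorem isUni_transvection {n p : ℕ} [NeZero p] {i j : Fin n} (h : i < j) (c : ZMod p) :
    IsUni (Matrix.transvection i j c) := by
  constructor
  · intro k
    have : ¬ (i = k ∧ j = k) := by rintro ⟨rfl, rfl⟩; exact lt_irrefl _ h
    simp [Matrix.transvection, Matrix.single_apply, this]
  · intro a b hab
    have hab' : b < a := hab
    have : ¬ (i = a ∧ j = b) := by rintro ⟨rfl, rfl⟩; exact lt_asymm h hab'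
    simp [Matrix.transvection, Matrix.single_apply, this, Matrix.one_apply, hab'.ne']

noncomputable def T {n p : ℕ} [NeZero p] {i j : Fin n} (h : i < j) (c : ZMod p) : ↥(Uni n p) :=
  mk (Matrix.transvection i j c) (isUni_transvection h c)

theorem T_mul {n p : ℕ} [NeZero p] {i j : Fin n} (h : i < j) (c d : ZMod p) :
    (T h c : ↥(Uni n p)) * T h d = T h (c + d) := by
  apply Subtype.ext
  apply Units.ext
  exact Matrix.transvection_mul_transvection_same _ _ h.ne c d

theorem T_comm {n p : ℕ} [NeZero p] {i k j : Fin n} (h : i < k) (h' : k < j) (c : ZMod p) :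
    (T h c : ↥(Uni n p)) * T h' 1 = T h' 1 * T h c * T (h.trans h') c := by
  apply Subtype.ext
  apply Units.ext
  show Matrix.transvection i k c * Matrix.transvection k j 1 =
    Matrix.transvection k j 1 * Matrix.transvection i k c * Matrix.transvection i j c
  simp [Matrix.transvection, Matrix.add_mul, Matrix.mul_add, h.ne, h.ne', h'.ne, h'.ne',
    (h.trans h').ne, (h.trans h').ne']
  abel

theorem entry_T {n p : ℕ} [NeZero p] {i j : Fin n} (h : i < j) (c : ZMod p) (a b : Fin n) :
    entry (T h c : ↥(Uni n p)) a b = (if a = b then 1 else 0) + if i = a ∧ j = b then c else 0 := by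
  show Matrix.transvection i j c a b = _
  simp [Matrix.transvection, Matrix.single_apply, Matrix.one_apply]

def genSet (n p : ℕ) [NeZero p] : Set ↥(Uni n p) :=
  {g | ∃ (i j : Fin n) (h : i < j) (c : ZMod p), g = T h c}

theorem closure_gen (n p : ℕ) [NeZero p] : Subgroup.closure (genSet n p) = ⊤ := by
  rw [eq_top_iff]
  intro g _
  suffices H : ∀ (N : ℕ) (g : ↥(Uni n p)),
      (Finset.univ.filter fun q : Fin n × Fin n => q.1 < q.2 ∧ entry g q.1 q.2 ≠ 0).card = N →
      g ∈ Subgroup.closure (genSet n p) from H _ g rfl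
  intro N
  induction N using Nat.strong_induction_on with
  | _ N ih =>
  intro g hg
  by_cases hex : ∃ i : Fin n, ∃ j, i < j ∧ entry g i j ≠ 0
  swap
  · push Not at hex
    have : g = 1 := by
      apply ext'
      intro i j
      rw [entry_one]
      rcases lt_trichotomy i j with h | rfl | h
      · rw [hex i j h, if_neg h.ne]
      · rw [entry_diag, if_pos rfl]
      · rw [entry_lower g h, if_neg h.ne']
    rw [this]; exact one_mem _
  obtain ⟨i, ⟨j, hij, hne⟩, hmin⟩ := WellFounded.has_min
    (wellFounded_lt : WellFounded ((· < ·) : Fin n → Fin n → Prop))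
    {i | ∃ j, i < j ∧ entry g i j ≠ 0} hex
  have hcol : ∀ a, entry g a i = if a = i then 1 else 0 := by
    intro a
    rcases lt_trichotomy a i with h | rfl | h
    · rw [if_neg h.ne]
      by_contra hc
      exact hmin a ⟨i, h, hc⟩ h
    · rw [entry_diag, if_pos rfl]
    · rw [entry_lower g h, if_neg h.ne']
  have hent : ∀ a b, entry (g * T hij (-entry g i j)) a b =
      if a = i ∧ b = j then 0 else entry g a b := by
    intro a b
    rw [entry_mul]
    simp only [entry_T, mul_add, Finset.sum_add_distrib]
    have h1 : ∑ x, entry g a x * (if x = b then (1 : ZMod p) else 0) = entry g a b := by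
      simp
    have h2 : ∑ x, entry g a x * (if i = x ∧ j = b then -entry g i j else 0) =
        entry g a i * (if j = b then - entry g i j else 0) := by
      rw [Finset.sum_eq_single i]
      · simp
      · intro x _ hx; simp [Ne.symm hx]
      · simp
    rw [h1, h2, hcol]
    by_cases ha : a = i <;> by_cases hb : b = j
    · subst ha hb; simp
    · subst ha; simp [hb, Ne.symm hb]
    · subst hb; simp [ha]
    · simp [ha]
  have hmem : g * T hij (-entry g i j) ∈ Subgroup.closure (genSet n p) := by
    refine ih _ ?_ _ rfl
    rw [← hg]
    apply Finset.card_lt_card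
    rw [Finset.ssubset_iff_of_subset]
    · refine ⟨(i, j), by simp [hij, hne], by simp [hent]⟩
    · intro q hq
      simp only [Finset.mem_filter, Finset.mem_univ, true_and, hent] at hq ⊢
      refine ⟨hq.1, fun h => hq.2 ?_⟩
      split_ifs
      · rfl
      · exact h
  have hT : T hij (-entry g i j) ∈ Subgroup.closure (genSet n p) :=
    Subgroup.subset_closure ⟨i, j, hij, _, rfl⟩
  exact (Subgroup.mul_mem_cancel_right _ hT).1 hmem

theorem hom_T {n p : ℕ} [NeZero p] {A : Type*} [CommGroup A] (φ : ↥(Uni n p) →* A)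
    {i j : Fin n} (h : i < j) (c : ZMod p) : φ (T h c) = φ (T h 1) ^ c.val := by
  have : ∀ k : ℕ, φ (T h (k : ZMod p)) = φ (T h 1) ^ k := by
    intro k
    induction k with
    | zero =>
      have : (T h ((0 : ℕ) : ZMod p) : ↥(Uni n p)) = 1 := by
        apply ext'; intro a b; rw [entry_T, entry_one]; simp
      rw [this]; simp
    | succ k ih => rw [Nat.cast_succ, ← T_mul, map_mul, ih, pow_succ]
  rw [← this, ZMod.natCast_zmod_val]

theorem hom_ext {n p : ℕ} [NeZero p] {A : Type*} [CommGroup A] (φ ψ : ↥(Uni (n + 1) p) →* A)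
    (H : ∀ i : Fin n, φ (T (Fin.castSucc_lt_succ (i := i)) 1) = ψ (T (Fin.castSucc_lt_succ (i := i)) 1)) :
    φ = ψ := by
  have hc : ∀ (χ : ↥(Uni (n + 1) p) →* A) {i k j : Fin (n + 1)} (h : i < k) (h' : k < j)
      (c : ZMod p), χ (T (h.trans h') c) = 1 := by
    intro χ i k j h h' c
    have := congrArg χ (T_comm h h' c)
    simp only [map_mul] at this
    rw [mul_comm (χ (T h' 1))] at this
    simpa using this
  refine MonoidHom.eq_of_eqOn_dense (closure_gen (n + 1) p) ?_
  rintro _ ⟨i, j, h, c, rfl⟩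
  by_cases hk : ∃ k, i < k ∧ k < j
  · obtain ⟨k, h1, h2⟩ := hk
    rw [hc φ h1 h2 c, hc ψ h1 h2 c]
  · push Not at hk
    have hi : (i : ℕ) < n := by have := j.2; have : (i : ℕ) < j := h; omega
    obtain ⟨i', rfl⟩ : ∃ i' : Fin n, i = i'.castSucc := ⟨⟨i, hi⟩, rfl⟩
    have hj : j = i'.succ := le_antisymm (hk _ Fin.castSucc_lt_succ) (Fin.castSucc_lt_iff_succ_le.1 h)
    subst hj
    rw [hom_T φ, hom_T ψ, H i']

theorem exists_functional {n p : ℕ} [Fact p.Prime] [NeZero p] (H : Subgroup ↥(Uni (n + 1) p))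
    (hH : H ≠ ⊤) : ∃ c : Fin n → ZMod p, c ≠ 0 ∧
      ∀ h ∈ H, ∑ i, c i * entry h i.castSucc i.succ = 0 := by
  have hfin : Finite ↥(Uni (n + 1) p) := inferInstance
  obtain ⟨N, hN, hHN⟩ := (eq_top_or_exists_le_coatom H).resolve_left hH
  have hpg := isPGroup (n + 1) p
  have := hpg.isNilpotent
  have : N.Normal := Subgroup.NormalizerCondition.normal_of_coatom N
    Group.normalizerCondition_of_isNilpotent hN
  have hcard : Nat.card (↥(Uni (n + 1) p) ⧸ N) = p := by
    have hq : IsPGroup p (↥(Uni (n + 1) p) ⧸ N) := hpg.to_quotient N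
    have : Nontrivial (↥(Uni (n + 1) p) ⧸ N) :=
      QuotientGroup.nontrivial_iff.2 hN.1
    have hdvd : p ∣ Nat.card (↥(Uni (n + 1) p) ⧸ N) := by
      obtain ⟨k, hk0, hk⟩ := (IsPGroup.nontrivial_iff_card hq).1 this
      rw [hk]; exact dvd_pow_self p hk0.ne'
    obtain ⟨x, hx⟩ := exists_prime_orderOf_dvd_card' p hdvd
    have hlt : N < (Subgroup.zpowers x).comap (QuotientGroup.mk' N) := by
      refine lt_of_le_of_ne ?_ ?_
      · intro y hy
        rw [Subgroup.mem_comap, (QuotientGroup.eq_one_iff y).2 hy |> fun h => (show QuotientGroup.mk' N y = 1 from h)]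
        exact one_mem _
      · intro heq
        obtain ⟨y, rfl⟩ := QuotientGroup.mk'_surjective N x
        have hy : y ∈ N := by
          rw [heq, Subgroup.mem_comap]; exact Subgroup.mem_zpowers _
        have : QuotientGroup.mk' N y = 1 := (QuotientGroup.eq_one_iff y).2 hy
        rw [this, orderOf_one] at hx
        exact (Fact.out : p.Prime).one_lt.ne hx
    have htop := hN.2 _ hlt
    have hz : Subgroup.zpowers x = ⊤ := by
      rw [← Subgroup.comap_injective (QuotientGroup.mk'_surjective N) |>.eq_iff, htop,
        Subgroup.comap_top]
    refine Eq.trans ?_ hx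
    rw [← Nat.card_zpowers, hz, Subgroup.card_top]
  let ε : (↥(Uni (n + 1) p) ⧸ N) ≃* Multiplicative (ZMod p) :=
    mulEquivOfPrimeCardEq (p := p) hcard (by simp)
  let φ : ↥(Uni (n + 1) p) →* Multiplicative (ZMod p) :=
    ε.toMonoidHom.comp (QuotientGroup.mk' N)
  let c : Fin n → ZMod p := fun i => (φ (T (Fin.castSucc_lt_succ (i := i)) 1)).toAdd
  have hs : ∀ (g h : ↥(Uni (n + 1) p)) (i : Fin n), entry (g * h) i.castSucc i.succ =
      entry g i.castSucc i.succ + entry h i.castSucc i.succ := by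
    intro g h i
    rw [entry_mul, ← Finset.sum_subset (Finset.subset_univ {i.castSucc, i.succ}),
      Finset.sum_pair Fin.castSucc_lt_succ.ne, entry_diag, entry_diag]
    · ring
    · intro x _ hx
      simp only [Finset.mem_insert, Finset.mem_singleton, not_or] at hx
      rcases lt_or_gt_of_ne hx.1 with h1 | h1
      · rw [entry_lower g h1, zero_mul]
      · have : i.succ < x := lt_of_le_of_ne (Fin.castSucc_lt_iff_succ_le.1 h1) (Ne.symm hx.2)
        rw [entry_lower h this, mul_zero]
  let ψ : ↥(Uni (n + 1) p) →* Multiplicative (ZMod p) := MonoidHom.mk'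
    (fun g => Multiplicative.ofAdd (∑ i, c i * entry g i.castSucc i.succ)) (by
      intro g h
      rw [← ofAdd_add, ← Finset.sum_add_distrib]
      simp only [hs, mul_add])
  have hφψ : φ = ψ := by
    apply hom_ext
    intro i
    show _ = Multiplicative.ofAdd _
    rw [Finset.sum_eq_single i]
    · simp [entry_T, c, Fin.castSucc_lt_succ.ne]
    · intro j _ hj
      simp [entry_T, Fin.castSucc_lt_succ.ne, Ne.symm hj]
    · simp
  refine ⟨c, ?_, ?_⟩
  · intro hc0
    apply hN.1
    rw [eq_top_iff]
    intro g _
    have : φ g = 1 := by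
      rw [hφψ]
      show Multiplicative.ofAdd _ = 1
      simp [hc0]
    have h2 : QuotientGroup.mk' N g = 1 := ε.injective (by rw [map_one]; exact this)
    exact (QuotientGroup.eq_one_iff g).1 h2
  · intro h hh
    have h2 : QuotientGroup.mk' N h = 1 := (QuotientGroup.eq_one_iff h).2 (hHN hh)
    have h3 : φ h = 1 := by
      show ε (QuotientGroup.mk' N h) = 1
      rw [h2, map_one]
    rw [hφψ] at h3
    exact Multiplicative.ofAdd.injective h3

theorem mem_range_of_fixed {k Ω : Type*} [Field k] [Field Ω] [Algebra k Ω] [Normal k Ω] {z : Ω}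
    (hs : IsSeparable k z) (h : ∀ g : Ω ≃ₐ[k] Ω, g z = z) : z ∈ (algebraMap k Ω).range := by
  rw [← minpoly.natDegree_eq_one_iff, ← Polynomial.card_rootSet_eq_natDegree hs (Normal.splits inferInstance z)]
  rw [Fintype.card_eq_one_iff]
  have hint : IsIntegral k z := hs.isIntegral
  refine ⟨⟨z, ?_⟩, ?_⟩
  · rw [Polynomial.mem_rootSet]
    exact ⟨minpoly.ne_zero hint, minpoly.aeval _ _⟩
  · rintro ⟨y, hy⟩
    rw [Polynomial.mem_rootSet] at hy
    obtain ⟨g, hg⟩ := minpoly.exists_algEquiv_of_root hint.isAlgebraic hy.2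
    apply Subtype.ext
    show y = z
    exact g.injective (by rw [hg, h])

theorem isSeparable_of_pow {k Ω : Type*} [Field k] [Field Ω] [Algebra k Ω] {p : ℕ}
    (hp : (p : k) ≠ 0) {z : Ω} {a : k} (ha : a ≠ 0) (hz : z ^ p = algebraMap k Ω a) :
    IsSeparable k z := by
  refine (Polynomial.separable_X_pow_sub_C a hp ha).of_dvd (minpoly.dvd k z ?_)
  simp [hz]

/-- the matrix obtained by adding a column -/
def ext1 {n : ℕ} {R : Type*} [CommRing R] (A : Fin n → Fin n → R) (x : Fin n → R) :
    Fin (n + 1) → Fin (n + 1) → R :=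
  fun i j => Fin.lastCases (motive := fun _ => R)
    (Fin.lastCases (motive := fun _ => R) 1 (fun _ => 0) j)
    (fun i' => Fin.lastCases (motive := fun _ => R) (x i') (fun j' => A i' j') j) i

section ext1
variable {n : ℕ} {R : Type*} [CommRing R] (A : Fin n → Fin n → R) (x : Fin n → R)

theorem ext1_ll : ext1 A x (Fin.last n) (Fin.last n) = 1 := by simp [ext1]
theorem ext1_lc (j : Fin n) : ext1 A x (Fin.last n) j.castSucc = 0 := by simp [ext1]
theorem ext1_cl (i : Fin n) : ext1 A x i.castSucc (Fin.last n) = x i := by simp [ext1]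
theorem ext1_cc (i j : Fin n) : ext1 A x i.castSucc j.castSucc = A i j := by simp [ext1]

theorem ext1_isUni (hA : IsUni (A : Matrix (Fin n) (Fin n) R)) :
    IsUni (ext1 A x : Matrix (Fin (n + 1)) (Fin (n + 1)) R) := by
  constructor
  · intro i
    refine Fin.lastCases ?_ (fun i => ?_) i
    · exact ext1_ll A x
    · rw [ext1_cc]; exact hA.1 i
  · intro i j
    refine Fin.lastCases ?_ (fun i => ?_) i <;> refine Fin.lastCases ?_ (fun j => ?_) j
    · intro h; exact absurd h (lt_irrefl _)
    · intro _; exact ext1_lc A x j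
    · intro h; have := i.2; simp at h; omega
    · intro h; rw [ext1_cc]; exact hA.2 i j h

end ext1

/-- assembling a homomorphism to the bigger unitriangular group from a cocycle -/
noncomputable def extHom {G : Type*} [Group G] {n p : ℕ} [NeZero p] (ρ : G →* ↥(Uni n p))
    (x : G → Fin n → ZMod p)
    (hx : ∀ g h i, x (g * h) i = ∑ k, entry (ρ g) i k * x h k + x g i) :
    G →* ↥(Uni (n + 1) p) :=
  MonoidHom.mk' (fun g => mk (ext1 (fun i j => entry (ρ g) i j) (x g))
    (ext1_isUni _ _ (entry_isUni (ρ g)))) (by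
      intro g h
      apply ext'
      intro i j
      rw [entry_mul, Fin.sum_univ_castSucc]
      change ext1 (fun i j => entry (ρ (g * h)) i j) (x (g * h)) i j =
        ∑ k : Fin n, ext1 (fun i j => entry (ρ g) i j) (x g) i k.castSucc *
          ext1 (fun i j => entry (ρ h) i j) (x h) k.castSucc j +
        ext1 (fun i j => entry (ρ g) i j) (x g) i (Fin.last n) *
          ext1 (fun i j => entry (ρ h) i j) (x h) (Fin.last n) j
      refine Fin.lastCases ?_ (fun i => ?_) i <;> refine Fin.lastCases ?_ (fun j => ?_) j
      · simp [ext1_ll, ext1_lc]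
      · simp [ext1_lc]
      · simp only [ext1_cl, ext1_cc, ext1_ll, hx, mul_one]
      · simp only [ext1_cl, ext1_cc, ext1_lc, mul_zero, add_zero, map_mul, entry_mul])

section
variable {G : Type*} [Group G] {n p : ℕ} [NeZero p] (ρ : G →* ↥(Uni n p))
    (x : G → Fin n → ZMod p)
    (hx : ∀ g h i, x (g * h) i = ∑ k, entry (ρ g) i k * x h k + x g i)

theorem extHom_cl (g : G) (i : Fin n) :
    entry (extHom ρ x hx g) i.castSucc (Fin.last n) = x g i := ext1_cl _ _ i

theorem extHom_cc (g : G) (i j : Fin n) :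
    entry (extHom ρ x hx g) i.castSucc j.castSucc = entry (ρ g) i j := ext1_cc _ _ i j

theorem extHom_eq_one (g : G) : extHom ρ x hx g = 1 ↔ ρ g = 1 ∧ x g = 0 := by
  constructor
  · intro h
    constructor
    · apply ext'
      intro i j
      rw [← extHom_cc ρ x hx, h, entry_one, entry_one]
      simp
    · funext i
      rw [← extHom_cl ρ x hx, h, entry_one, if_neg (Fin.castSucc_lt_last i).ne]
      rfl
  · rintro ⟨h1, h2⟩
    apply ext'
    intro i j
    rw [entry_one]
    show ext1 _ _ i j = _
    refine Fin.lastCases ?_ (fun i => ?_) i <;> refine Fin.lastCases ?_ (fun j => ?_) j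
    · simp [ext1_ll]
    · rw [ext1_lc, if_neg (Fin.castSucc_lt_last j).ne']
    · rw [ext1_cl, if_neg (Fin.castSucc_lt_last i).ne, h2]; rfl
    · rw [ext1_cc, h1, entry_one]; simp

/-- conjugation: if all conjugates of `g` have trivial first coordinate, then `x g = 0` -/
theorem x_eq_zero
    (hx : ∀ g h i, x (g * h) i = ∑ k, entry (ρ g) i k * x h k + x g i) (hρ : Function.Surjective ρ) (i0 : Fin n) (hi0 : ∀ j, i0 ≤ j) (g : G)
    (hg : ρ g = 1) (H : ∀ h : G, x (h * g * h⁻¹) i0 = 0) : x g = 0 := by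
  have key : ∀ h : G, ∑ k, entry (ρ h) i0 k * x g k = 0 := by
    intro h
    have h1 := hx h g i0
    have h2 := hx (h * g * h⁻¹) h i0
    have h3 : ρ (h * g * h⁻¹) = 1 := by simp [hg]
    rw [inv_mul_cancel_right, h3, H h, h1] at h2
    simpa [entry_one] using h2
  have h0 : x g i0 = 0 := by
    have := key 1
    simpa [entry_one] using this
  funext j
  rcases (hi0 j).eq_or_lt with rfl | hj
  · exact h0
  · obtain ⟨h, hh⟩ := hρ (T hj 1)
    have := key h
    rw [hh] at this
    simp only [entry_T, add_mul, Finset.sum_add_distrib] at this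
    simpa [h0] using this

end

theorem chi_inj {Ω : Type*} [Field Ω] {p : ℕ} [NeZero p] {z : Ω} (hz : IsPrimitiveRoot z p)
    {a b : ZMod p} (h : z ^ a.val = z ^ b.val) : a = b :=
  ZMod.val_injective p (hz.pow_inj a.val_lt b.val_lt h)

theorem chi_add {Ω : Type*} [Field Ω] {p : ℕ} [NeZero p] {z : Ω} (hz : z ^ p = 1)
    (a b : ZMod p) : z ^ (a + b).val = z ^ a.val * z ^ b.val := by
  rw [← AddChar.zmodChar_apply hz, ← AddChar.zmodChar_apply hz, ← AddChar.zmodChar_apply hz,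
    AddChar.map_add_eq_mul]

theorem chi_sum {Ω ι : Type*} [Field Ω] {p : ℕ} [NeZero p] {z : Ω} (hz : z ^ p = 1)
    (s : Finset ι) (f : ι → ZMod p) : z ^ (∑ i ∈ s, f i).val = ∏ i ∈ s, z ^ (f i).val := by
  classical
  induction s using Finset.induction_on with
  | empty => simp
  | insert i s hi ih => rw [Finset.sum_insert hi, Finset.prod_insert hi, chi_add hz, ih]

theorem chi_mul {Ω : Type*} [Field Ω] {p : ℕ} [NeZero p] {z : Ω} (hz : z ^ p = 1)
    (a b : ZMod p) : z ^ (a * b).val = (z ^ a.val) ^ b.val := by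
  rw [← pow_mul, ZMod.val_mul, ← pow_mod_orderOf, ← pow_mod_orderOf _ (a.val * b.val)]
  congr 1
  exact Nat.mod_mod_of_dvd _ (orderOf_dvd_of_pow_eq_one hz)

theorem exists_chi {Ω : Type*} [Field Ω] {p : ℕ} [NeZero p] {z : Ω} (hz : IsPrimitiveRoot z p)
    {x y : Ω} (hy : y ≠ 0) (h : x ^ p = y ^ p) : ∃ c : ZMod p, x = z ^ c.val * y := by
  obtain ⟨i, hi, hxi⟩ := hz.eq_pow_of_pow_eq_one (ξ := x / y) (by
    rw [div_pow, h, div_self (pow_ne_zero _ hy)])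
  refine ⟨(i : ZMod p), ?_⟩
  rw [ZMod.val_natCast_of_lt hi, hxi, div_mul_cancel₀ _ hy]

end UniAux

set_option maxHeartbeats 4000000 in
/-- Let `p` be a prime, `n ≥ 2`, `F` a field with a primitive `p`-th root of unity `ζ` and
algebraic closure `Ω`, and `K/F` a finite Galois extension inside `Ω` equipped with an
isomorphism `e : Gal(K/F) ≅ U_n(F_p)` compatible with `a 0, …, a (n−2) ∈ F^×`. Let
`a (n-1) ∈ F^×` be a norm from `K`, say `N_{K/F}(w) = a (n-1)` with `w ∈ K^×`, and assume
`a 0, …, a (n-1)` are linearly independent in `F^×/(F^×)^p`. For `σ ∈ Gal(K/F)` let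
`λ_σ ∈ {0, …, p−1}` represent the top-right entry of `e σ`, set
`v = ∏_σ σ(w)^{λ_σ} ∈ K^×`, let `β ∈ Ω` satisfy `β^p = v`, and let `M` be the normal
closure of `K(β)` over `F` inside `Ω`. Then `M/F` is a finite Galois extension and there
is an isomorphism `e' : Gal(M/F) ≅ U_{n+1}(F_p)` for which `M/F` is compatible with
`a 0, …, a (n-1)`. -/
theorem stmt_15 (p n : ℕ) [Fact p.Prime] [NeZero p] (hn : 2 ≤ n)
    (F Ω : Type) [Field F] [Field Ω] [Algebra F Ω] [IsAlgClosure F Ω]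
    (ζ : F) (hζ : IsPrimitiveRoot ζ p)
    (K : IntermediateField F Ω) [FiniteDimensional F K] [IsGalois F K]
    (e : (↥K ≃ₐ[F] ↥K) ≃* ↥(Uni n p))
    (a : ℕ → F) (ha : ∀ i, i < n → a i ≠ 0)
    (α : ℕ → ↥K)
    (hcompat : ∀ i : ℕ, ∀ hi : i + 1 < n,
      α i ^ p = algebraMap F ↥K (a i) ∧
      ∀ σ : ↥K ≃ₐ[F] ↥K,
        σ (α i) = algebraMap F ↥K ζ ^
            (entry (e σ) ⟨i, by omega⟩ ⟨i + 1, hi⟩).val * α i)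
    (w : ↥K) (hw0 : w ≠ 0) (hw : Algebra.norm F w = a (n - 1))
    (hind : ∀ eexp : ℕ → ℕ, (∀ i, i < n → eexp i < p) → (∃ i, i < n ∧ eexp i ≠ 0) →
      ¬∃ y : F, y ^ p = ∏ i ∈ Finset.range n, a i ^ eexp i)
    (v : ↥K)
    (hv : v = ∏ σ : ↥K ≃ₐ[F] ↥K,
      σ w ^ (entry (e σ) ⟨0, by omega⟩ ⟨n - 1, by omega⟩).val)
    (β : Ω) (hβ : β ^ p = algebraMap (↥K) Ω v)
    (K' : IntermediateField F Ω)
    (hK' : K' = IntermediateField.adjoin F ((K : Set Ω) ∪ {β}))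
    (M : IntermediateField F Ω) (hM : M = normalClosure F (↥K') Ω) :
    FiniteDimensional F M ∧ IsGalois F M ∧
      ∃ e' : (↥M ≃ₐ[F] ↥M) ≃* ↥(Uni (n + 1) p),
        ∃ αM : ℕ → ↥M, ∀ i : ℕ, ∀ hi : i < n,
          αM i ^ p = algebraMap F ↥M (a i) ∧
          ∀ σ : ↥M ≃ₐ[F] ↥M,
            σ (αM i) = algebraMap F ↥M ζ ^
                (entry (e' σ) ⟨i, by omega⟩ ⟨i + 1, by omega⟩).val * αM i := by
  have hpprime : p.Prime := Fact.out
  have hpF : (p : F) ≠ 0 := by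
    have := hζ.neZero' 
    exact this.out
  have : IsAlgClosed Ω := IsAlgClosure.isAlgClosed F
  have : Algebra.IsAlgebraic F Ω := IsAlgClosure.isAlgebraic
  have : Normal F Ω := inferInstance
  set z : Ω := algebraMap F Ω ζ with hz
  have hzp : IsPrimitiveRoot z p := hζ.map_of_injective (algebraMap F Ω).injective
  have hz1 : z ^ p = 1 := hzp.pow_eq_one
  -- restriction to K
  let res : (Ω ≃ₐ[F] Ω) →* (↥K ≃ₐ[F] ↥K) := AlgEquiv.restrictNormalHom ↥K
  have hres : ∀ (g : Ω ≃ₐ[F] Ω) (y : ↥K), ((res g y : ↥K) : Ω) = g (y : Ω) :=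
    fun g y => AlgEquiv.restrictNormal_commutes g ↥K y
  have hres_surj : Function.Surjective res := AlgEquiv.restrictNormalHom_surjective Ω
  let ρ : (Ω ≃ₐ[F] Ω) →* ↥(Uni n p) := e.toMonoidHom.comp res
  have hρ_surj : Function.Surjective ρ := e.surjective.comp hres_surj
  have hgz : ∀ (g : Ω ≃ₐ[F] Ω) (k : ℕ), g (z ^ k) = z ^ k := by
    intro g k; rw [map_pow, hz, AlgEquiv.commutes]
  -- roots of conjugates of w
  have hω : ∀ σ : ↥K ≃ₐ[F] ↥K, ∃ y : Ω, y ^ p = ((σ w : ↥K) : Ω) := fun σ =>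
    IsAlgClosed.exists_pow_nat_eq _ hpprime.pos
  choose ω hω using hω
  have hω0 : ∀ σ, ω σ ≠ 0 := by
    intro σ h
    have h1 := hω σ
    rw [h, zero_pow hpprime.ne_zero] at h1
    have h2 : σ w = 0 := Subtype.ext h1.symm
    exact hw0 (by simpa using h2)
  have hc : ∀ (g : Ω ≃ₐ[F] Ω) (σ : ↥K ≃ₐ[F] ↥K), ∃ c : ZMod p,
      g (ω σ) = z ^ c.val * ω (res g * σ) := by
    intro g σ
    apply UniAux.exists_chi hzp (hω0 _)
    rw [← map_pow, hω, hω, AlgEquiv.mul_apply, hres]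
  choose c hc using hc
  have hcoc : ∀ g h σ, c (g * h) σ = c h σ + c g (res h * σ) := by
    intro g h σ
    apply UniAux.chi_inj hzp
    apply mul_right_cancel₀ (hω0 (res (g * h) * σ))
    rw [← hc, UniAux.chi_add hz1, AlgEquiv.mul_apply, hc h, map_mul, hgz, hc g, map_mul res, mul_assoc (res g)]
    ring
  let l : Fin n := ⟨n - 1, by omega⟩
  let i0 : Fin n := ⟨0, by omega⟩
  let x : (Ω ≃ₐ[F] Ω) → Fin n → ZMod p := fun g i => ∑ σ, c g σ * entry (e (res g * σ)) i l
  have hx : ∀ g h i, x (g * h) i = ∑ k, entry (ρ g) i k * x h k + x g i := by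
    intro g h i
    simp only [x, hcoc, add_mul, Finset.sum_add_distrib]
    congr 1
    · simp only [Finset.mul_sum]
      rw [Finset.sum_comm]
      refine Finset.sum_congr rfl fun σ _ => ?_
      rw [map_mul res, mul_assoc, map_mul e, UniAux.entry_mul, Finset.mul_sum]
      refine Finset.sum_congr rfl fun k _ => ?_
      show _ = entry (e (res g)) i k * _
      ring
    · rw [← Equiv.sum_comp (Equiv.mulLeft (res h)) (fun σ => c g σ * entry (e (res g * σ)) i l)]
      refine Finset.sum_congr rfl fun σ _ => ?_
      rw [Equiv.coe_mulLeft, map_mul res, mul_assoc]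
  let E : (Ω ≃ₐ[F] Ω) →* ↥(Uni (n + 1) p) := UniAux.extHom ρ x hx
  -- the generators
  let A : ℕ → Ω := fun i => if i + 1 < n then ((α i : ↥K) : Ω) else ∏ σ, ω σ
  have hA : ∀ i (hi : i < n), A i ^ p = algebraMap F Ω (a i) ∧ ∀ g : Ω ≃ₐ[F] Ω,
      g (A i) = z ^ (entry (E g) ⟨i, by omega⟩ ⟨i + 1, by omega⟩).val * A i := by
    intro i hi
    by_cases h : i + 1 < n
    · have hAi : A i = ((α i : ↥K) : Ω) := if_pos h
      rw [hAi]
      obtain ⟨h1, h2⟩ := hcompat i h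
      constructor
      · have := congrArg (algebraMap ↥K Ω) h1
        rw [map_pow, ← IsScalarTower.algebraMap_apply] at this
        exact this
      · intro g
        have h3 := congrArg (algebraMap ↥K Ω) (h2 (res g))
        rw [map_mul, map_pow, ← IsScalarTower.algebraMap_apply] at h3
        have h4 := UniAux.extHom_cc ρ x hx g ⟨i, hi⟩ ⟨i + 1, h⟩
        rw [← hres]
        refine h3.trans ?_
        congr 2
        exact congrArg ZMod.val h4.symm
    · have hAi : A i = ∏ σ, ω σ := if_neg h
      have hin : i = n - 1 := by omega
      rw [hAi]
      constructor
      · rw [← Finset.prod_pow, hin, ← hw, IsScalarTower.algebraMap_apply F ↥K Ω,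
          Algebra.norm_eq_prod_automorphisms, map_prod]
        exact Finset.prod_congr rfl fun σ _ => hω σ
      · intro g
        have h4 : entry (E g) ⟨i, by omega⟩ ⟨i + 1, by omega⟩ = ∑ σ, c g σ := by
          have h5 := UniAux.extHom_cl ρ x hx g l
          have h6 : x g l = ∑ σ, c g σ := by simp [x, UniAux.entry_diag]
          rw [← h6, ← h5]
          congr 1
          · exact Fin.ext hin
          · apply Fin.ext; simp; omega
        rw [h4, UniAux.chi_sum hz1, map_prod]
        simp only [hc, Finset.prod_mul_distrib]
        congr 1
        exact Equiv.prod_comp (Equiv.mulLeft (res g)) ω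
  have hAsep : ∀ i, i < n → IsSeparable F (A i) := fun i hi =>
    UniAux.isSeparable_of_pow hpF (ha i hi) (hA i hi).1
  have hA0 : ∀ i, i < n → A i ≠ 0 := by
    intro i hi h
    have h1 := (hA i hi).1
    rw [h, zero_pow hpprime.ne_zero] at h1
    exact ha i hi ((algebraMap F Ω).injective (by rw [← h1, map_zero]))
  -- surjectivity
  have hE_surj : Function.Surjective E := by
    rw [← MonoidHom.range_eq_top]
    by_contra hne
    obtain ⟨d, hd0, hd⟩ := UniAux.exists_functional E.range hne
    let ee : ℕ → ℕ := fun i => if h : i < n then (d ⟨i, h⟩).val else 0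
    have hee : ∀ i : Fin n, ee i = (d i).val := fun i => dif_pos i.2
    refine hind ee (fun i hi => ?_) ?_ ?_
    · rw [show ee i = _ from hee ⟨i, hi⟩]; exact ZMod.val_lt _
    · obtain ⟨i, hi⟩ := Function.ne_iff.1 hd0
      refine ⟨i, i.2, ?_⟩
      rw [hee]
      exact fun h => hi ((ZMod.val_eq_zero _).1 h)
    · have hpow : (∏ i ∈ Finset.range n, A i ^ ee i) ^ p =
          algebraMap F Ω (∏ i ∈ Finset.range n, a i ^ ee i) := by
        rw [← Finset.prod_pow, map_prod]
        refine Finset.prod_congr rfl fun i hi => ?_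
        rw [map_pow, ← (hA i (Finset.mem_range.1 hi)).1, ← pow_mul, ← pow_mul, mul_comm]
      have hmem : (∏ i ∈ Finset.range n, A i ^ ee i) ∈ (algebraMap F Ω).range := by
        apply UniAux.mem_range_of_fixed
        · refine UniAux.isSeparable_of_pow hpF ?_ hpow
          exact Finset.prod_ne_zero_iff.2 fun i hi => pow_ne_zero _ (ha i (Finset.mem_range.1 hi))
        · intro g
          have h1 := hd (E g) ⟨g, rfl⟩
          rw [Finset.prod_range (n := n), map_prod]
          calc ∏ i : Fin n, g (A i ^ ee i)
              = ∏ i : Fin n, (z ^ (d i * entry (E g) i.castSucc i.succ).val * A i ^ ee i) := by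
                refine Finset.prod_congr rfl fun i _ => ?_
                rw [map_pow, (hA i i.2).2 g, mul_pow, mul_comm (d i), UniAux.chi_mul hz1, hee]
                rfl
            _ = _ := by
                rw [Finset.prod_mul_distrib, ← UniAux.chi_sum hz1, h1]
                simp
      obtain ⟨y, hy⟩ := hmem
      refine ⟨y, (algebraMap F Ω).injective ?_⟩
      rw [map_pow, hy, hpow]
  -- finiteness and separability
  have hv0 : v ≠ 0 := by
    rw [hv]
    exact Finset.prod_ne_zero_iff.2 fun σ _ => pow_ne_zero _ (by simpa using hw0)
  have hβ0 : β ≠ 0 := by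
    intro h
    rw [h, zero_pow hpprime.ne_zero] at hβ
    exact hv0 ((algebraMap ↥K Ω).injective (by rw [← hβ, map_zero]))
  have hβsep : IsSeparable F β := by
    apply IsSeparable.of_algebra_isSeparable_of_isSeparable (E := ↥K) F
    refine UniAux.isSeparable_of_pow (p := p) ?_ hv0 hβ
    intro h
    apply hpF
    apply (algebraMap F ↥K).injective
    rw [map_natCast, h, map_zero]
  have hK'sup : K' = K ⊔ F⟮β⟯ := by
    rw [hK', adjoin_union, adjoin_self]
  have hKK' : K ≤ K' := hK'sup ▸ le_sup_left
  have hβK' : β ∈ K' := by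
    rw [hK']; exact subset_adjoin _ _ (Or.inr rfl)
  have hK'fin : FiniteDimensional F ↥K' := by
    have : FiniteDimensional F F⟮β⟯ := adjoin.finiteDimensional hβsep.isIntegral
    rw [hK'sup]
    exact IntermediateField.finiteDimensional_sup _ _
  have hMfin : FiniteDimensional F ↥M := by
    rw [hM]; exact normalClosure.is_finiteDimensional F ↥K' Ω
  have hMnormal : Normal F ↥M := by
    rw [hM]; exact normalClosure.normal F ↥K' Ω
  have hMsep : Algebra.IsSeparable F ↥M := by
    rw [← le_separableClosure_iff, hM, ← separableClosure.normalClosure_eq_self]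
    apply normalClosure_mono
    rw [le_separableClosure_iff, hK', isSeparable_adjoin_iff_isSeparable]
    rintro y (hy | rfl)
    · exact mem_separableClosure_iff.1 ((le_separableClosure_iff F Ω K).2 inferInstance hy)
    · exact hβsep
  have hMgal : IsGalois F ↥M := ⟨⟩
  refine ⟨hMfin, hMgal, ?_⟩
  -- restriction to M
  let resM : (Ω ≃ₐ[F] Ω) →* (↥M ≃ₐ[F] ↥M) := AlgEquiv.restrictNormalHom ↥M
  have hresM : ∀ (g : Ω ≃ₐ[F] Ω) (y : ↥M), ((resM g y : ↥M) : Ω) = g (y : Ω) :=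
    fun g y => AlgEquiv.restrictNormal_commutes g ↥M y
  have hresM_surj : Function.Surjective resM := AlgEquiv.restrictNormalHom_surjective Ω
  have hρ1 : ∀ g, ρ g = 1 ↔ ∀ y ∈ K, g y = y := by
    intro g
    rw [show ρ g = e (res g) from rfl, map_eq_one_iff e e.injective]
    constructor
    · intro h y hy
      have := hres g ⟨y, hy⟩
      rw [h] at this
      exact this.symm
    · intro h
      ext y
      rw [hres, h _ y.2]; rfl
  -- action on β
  have hβact : ∀ g, ρ g = 1 → g β = z ^ (x g i0).val * β := by
    intro g hg
    have hr : res g = 1 := e.injective (by rw [map_one]; exact hg)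
    obtain ⟨t, ht⟩ := UniAux.exists_chi hzp (x := β)
        (y := ∏ σ, ω σ ^ (entry (e σ) i0 l).val)
        (Finset.prod_ne_zero_iff.2 fun σ _ => pow_ne_zero _ (hω0 σ)) (by
      rw [hβ, hv, map_prod, ← Finset.prod_pow]
      refine Finset.prod_congr rfl fun σ _ => ?_
      rw [map_pow, ← pow_mul, mul_comm, pow_mul, hω]
      rfl)
    rw [ht, map_mul, hgz, map_prod]
    have : ∏ σ, g (ω σ ^ (entry (e σ) i0 l).val) =
        z ^ (x g i0).val * ∏ σ, ω σ ^ (entry (e σ) i0 l).val := by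
      simp only [x, hr, one_mul]
      rw [UniAux.chi_sum hz1, ← Finset.prod_mul_distrib]
      refine Finset.prod_congr rfl fun σ _ => ?_
      rw [map_pow, hc, hr, one_mul, mul_pow, UniAux.chi_mul hz1]
    rw [this]; ring
  have hfixK' : ∀ g : Ω ≃ₐ[F] Ω, E g = 1 → ∀ y ∈ K', g y = y := by
    intro g hg
    obtain ⟨h1, h2⟩ := (UniAux.extHom_eq_one ρ x hx g).1 hg
    have hle : K' ≤ fixedField (Subgroup.zpowers g) := by
      rw [hK', adjoin_le_iff]
      have key : ∀ y : Ω, g y = y → y ∈ fixedField (Subgroup.zpowers g) := by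
        intro y hy
        rw [mem_fixedField_iff]
        intro f hf
        have : Subgroup.zpowers g ≤ MulAction.stabilizer (Ω ≃ₐ[F] Ω) y := by
          rw [Subgroup.zpowers_le]; exact hy
        exact this hf
      rintro y (hy | rfl)
      · exact key y ((hρ1 g).1 h1 y hy)
      · apply key
        rw [hβact g h1, h2]; simp
    intro y hy
    exact (mem_fixedField_iff _ _).1 (hle hy) g (Subgroup.mem_zpowers g)
  have hker : ∀ g, E g = 1 ↔ resM g = 1 := by
    intro g
    constructor
    · intro hg
      have hle : M ≤ fixedField E.ker := by
        rw [hM, normalClosure_def'', iSup_le_iff]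
        rintro f _ ⟨y, hy, rfl⟩
        rw [mem_fixedField_iff]
        intro k hk
        have h1 : E (f⁻¹ * k * f) = 1 := by
          rw [map_mul, map_mul, (MonoidHom.mem_ker).1 hk, map_inv]; simp
        have h2 := hfixK' _ h1 y hy
        have h3 := congrArg f h2
        rw [← AlgEquiv.mul_apply, ← mul_assoc, ← mul_assoc, mul_inv_cancel, one_mul] at h3
        exact h3
      ext y
      rw [hresM]
      exact (mem_fixedField_iff _ _).1 (hle y.2) g hg
    · intro hg
      have hfix : ∀ y ∈ M, g y = y := by
        intro y hy
        have := hresM g ⟨y, hy⟩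
        rw [hg] at this
        exact this.symm
      have hK'M : K' ≤ M := hM ▸ le_normalClosure K'
      have hβM : ∀ h : Ω ≃ₐ[F] Ω, h β ∈ M := by
        intro h
        have := hresM h ⟨β, hK'M hβK'⟩
        rw [← this]; exact Subtype.mem _
      have h1 : ρ g = 1 := (hρ1 g).2 fun y hy => hfix y (hK'M (hKK' hy))
      refine (UniAux.extHom_eq_one ρ x hx g).2 ⟨h1, ?_⟩
      refine UniAux.x_eq_zero ρ x hx hρ_surj i0 (fun j => Nat.zero_le _) g h1 ?_
      intro h
      have h2 : ρ (h * g * h⁻¹) = 1 := by simp [h1]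
      have h3 := hβact _ h2
      have h4 : (h * g * h⁻¹) β = β := by
        rw [AlgEquiv.mul_apply, AlgEquiv.mul_apply, hfix _ (hβM _), ← AlgEquiv.mul_apply,
          mul_inv_cancel]; rfl
      rw [h4] at h3
      apply UniAux.chi_inj hzp
      apply mul_right_cancel₀ hβ0
      rw [← h3]; simp
  have hkereq : resM.ker = E.ker := by
    ext g
    rw [MonoidHom.mem_ker, MonoidHom.mem_ker, hker]
  let e' : (↥M ≃ₐ[F] ↥M) ≃* ↥(Uni (n + 1) p) :=
    (QuotientGroup.quotientKerEquivOfSurjective resM hresM_surj).symm.trans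
      ((QuotientGroup.quotientMulEquivOfEq hkereq).trans
        (QuotientGroup.quotientKerEquivOfSurjective E hE_surj))
  have he' : ∀ g, e' (resM g) = E g := by
    intro g
    have : (QuotientGroup.quotientKerEquivOfSurjective resM hresM_surj).symm (resM g) =
        (QuotientGroup.mk g : _ ⧸ resM.ker) := by
      rw [MulEquiv.symm_apply_eq]; rfl
    show (QuotientGroup.quotientKerEquivOfSurjective E hE_surj)
      (QuotientGroup.quotientMulEquivOfEq hkereq
        ((QuotientGroup.quotientKerEquivOfSurjective resM hresM_surj).symm (resM g))) = E g
    rw [this]; rfl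
  -- A i lies in M
  have hAM : ∀ i, i < n → A i ∈ M := by
    intro i hi
    have hmem : A i ∈ (algebraMap ↥M Ω).range := by
      have : Normal ↥M Ω := Normal.tower_top_of_normal F ↥M Ω
      apply UniAux.mem_range_of_fixed
      · exact IsSeparable.tower_top ↥M (hAsep i hi)
      · intro g
        have h1 : E (g.restrictScalars F) = 1 := by
          rw [hker]
          ext y
          rw [hresM]
          exact g.commutes y
        have h2 := (hA i hi).2 (g.restrictScalars F)
        rw [h1, UniAux.entry_one, if_neg (by simp)] at h2
        simpa using h2
    obtain ⟨y, hy⟩ := hmem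
    rw [← hy]; exact y.2
  refine ⟨e', fun i => if h : i < n then ⟨A i, hAM i h⟩ else 1, ?_⟩
  intro i hi
  simp only [dif_pos hi]
  constructor
  · apply Subtype.ext
    exact (hA i hi).1
  · intro σ
    obtain ⟨g, rfl⟩ := hresM_surj σ
    apply Subtype.ext
    rw [hresM, he']
    exact (hA i hi).2 g
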